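/- (Tangent law.) Let φ be a Jacob's ladder on [T₀,∞) with k₁T ≤ φ(T) ≤ k₂T for all T ≥ T₀ (for some constants 0 < k₁ ≤ k₂), and assume the Balasubramanian formula: for every ε > 0, ∫₀^T Z(t)² dt = T ln T + (2c − 1 − ln 2π)T + O(T^{1/3+ε}) as T → ∞. Then for every ε > 0, as T → ∞, uniformly for 0 < U ≤ U₀ = T^{1/3+2ε}, ∫_T^{T+U} Z(t)² dt = (U·ln(φ(T)/2) − aU)·tan α(T,U) + O(T^{−(1/3−4ε)}), where tan α(T,U) = [φ(T+U) − φ(T)]/(2U) is the slope of the chord of the curve y = φ(t)/2 joining the points (T, φ(T)/2) and (T+U, φ(T+U)/2), and a = ln(2π) − 1 − c. -/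

import Mathlib

open Real MeasureTheory Filter

/-- `Z(t)²`, i.e. `|ζ(1/2 + it)|²`. -/
noncomputable def Z2 (t : ℝ) : ℝ := ‖riemannZeta (1/2 + Complex.I * t)‖ ^ 2

/-- The constant `a = ln(2π) − 1 − c`, where `c` is the Euler–Mascheroni constant. -/
noncomputable def aConst : ℝ := Real.log (2 * Real.pi) - 1 - Real.eulerMascheroniConstant

theorem continuous_Z2 : Continuous Z2 := by
  have h : Continuous fun t : ℝ => riemannZeta (1/2 + Complex.I * t) := by
    rw [continuous_iff_continuousAt]
    intro t
    have hne : (1/2 + Complex.I * (t : ℂ)) ≠ 1 := by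
      intro h
      have := congrArg Complex.re h
      norm_num at this
    exact (differentiableAt_riemannZeta hne).continuousAt.comp_of_eq
      (f := fun t : ℝ => (1/2 + Complex.I * (t : ℂ))) (by fun_prop) rfl
  exact h.norm.pow 2

/-- The tangent-line bounds for the convex function `x ↦ x log x`. -/
theorem mul_log_sub_tangent_bounds {x y : ℝ} (hx : 0 < x) (hy : 0 < y) :
    0 ≤ y * log y - x * log x - (log x + 1) * (y - x) ∧
      y * log y - x * log x - (log x + 1) * (y - x) ≤ (y - x) ^ 2 / x := by
  have h1 : log y - log x ≤ y / x - 1 := by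
    rw [← log_div hy.ne' hx.ne']
    exact log_le_sub_one_of_pos (by positivity)
  have h2 : log x - log y ≤ x / y - 1 := by
    rw [← log_div hx.ne' hy.ne']
    exact log_le_sub_one_of_pos (by positivity)
  have h3 := mul_le_mul_of_nonneg_left h1 hy.le
  have h4 := mul_le_mul_of_nonneg_left h2 hy.le
  have e3 : y * (y / x - 1) = (y - x) ^ 2 / x + (y - x) := by field_simp; ring
  have e4 : y * (x / y - 1) = x - y := by field_simp
  constructor <;> nlinarith

theorem log_div_self_le_rpow {S T : ℝ} (hT : 1 ≤ T) (hTS : T ≤ S) :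
    log S / S ≤ 3 / 2 * T ^ (-(1 / 3) : ℝ) := by
  have hS : 0 < S := by linarith
  have h1 : log S ≤ S ^ (2 / 3 : ℝ) / (2 / 3) := log_le_rpow_div hS.le (by norm_num)
  have h2 : S ^ (2 / 3 : ℝ) = S ^ (-(1 / 3) : ℝ) * S := by
    rw [← rpow_add_one hS.ne']; norm_num
  have h3 : S ^ (-(1 / 3) : ℝ) ≤ T ^ (-(1 / 3) : ℝ) :=
    rpow_le_rpow_of_nonpos (by linarith) hTS (by norm_num)
  rw [div_le_iff₀ hS]
  nlinarith [mul_le_mul_of_nonneg_right h3 hS.le]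

theorem tangent_law
    (φ : ℝ → ℝ) (T₀ : ℝ)
    (hcont : ContinuousOn φ (Set.Ici T₀))
    (hmono : StrictMonoOn φ (Set.Ici T₀))
    (hpos : ∀ T ≥ T₀, 0 < φ T)
    (hladder : ∃ c₀ C : ℝ, ∀ T ≥ T₀,
      |(∫ t in (0:ℝ)..T, Z2 t) - (φ T / 2) * Real.log (φ T / 2)
        - (Real.eulerMascheroniConstant - Real.log (2 * Real.pi)) * (φ T / 2) - c₀|
        ≤ C * Real.log T / T)
    (k₁ k₂ : ℝ) (hk₁ : 0 < k₁) (hk₁₂ : k₁ ≤ k₂)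
    (hgrowth : ∀ T ≥ T₀, k₁ * T ≤ φ T ∧ φ T ≤ k₂ * T)
    (hBal : ∀ ε > (0:ℝ), ∃ C T₁ : ℝ, ∀ T ≥ T₁,
      |(∫ t in (0:ℝ)..T, Z2 t) - T * Real.log T
        - (2 * Real.eulerMascheroniConstant - 1 - Real.log (2 * Real.pi)) * T|
        ≤ C * T ^ ((1:ℝ)/3 + ε))
    : ∀ ε > (0:ℝ), ∃ C T₁ : ℝ, ∀ T ≥ T₁, ∀ U : ℝ, 0 < U → U ≤ T ^ ((1:ℝ)/3 + 2*ε) →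
      |(∫ t in T..(T + U), Z2 t)
        - (U * Real.log (φ T / 2) - aConst * U) * ((φ (T + U) - φ T) / (2 * U))|
        ≤ C * T ^ (-((1:ℝ)/3 - 4*ε)) := by
  intro ε hε
  obtain ⟨c₀, C, hC⟩ := hladder
  obtain ⟨B, T₁, hB⟩ := hBal ε hε
  set A : ℝ := 2 * eulerMascheroniConstant - 1 - log (2 * π) with hA
  set D : ℝ := eulerMascheroniConstant - log (2 * π) with hD
  set N : ℝ := |log (k₁ / 2)| + |aConst| with hN
  set K : ℝ := log 2 + 1 + |A| + 3 * |B| + 3 * |C| with hK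
  set R : ℝ := 4 + k₂ with hR
  have hk₂ : 0 < k₂ := by linarith
  refine ⟨3 * |C| + R ^ 2 * (2 / k₁), max (max T₀ T₁) (max 1 (exp (2 * N + K + 1))), ?_⟩
  intro T hT U hU hUM
  simp only [ge_iff_le, max_le_iff] at hT
  obtain ⟨⟨hT₀, hT₁⟩, hT1, hTe⟩ := hT
  have hT0 : 0 < T := by linarith
  set M : ℝ := T ^ ((1:ℝ)/3 + 2*ε) with hM
  have hM1 : 1 ≤ M := one_le_rpow hT1 (by positivity)
  have hS₀ : T₀ ≤ T + U := by linarith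
  set x : ℝ := φ T / 2 with hx
  set y : ℝ := φ (T + U) / 2 with hy
  have hx0 : 0 < x := by have := hpos T hT₀; positivity
  have hxy : x < y := by
    have : φ T < φ (T + U) := hmono hT₀ hS₀ (by linarith)
    linarith
  have hxT : k₁ / 2 * T ≤ x := by have := (hgrowth T hT₀).1; linarith
  have hyT : y ≤ k₂ / 2 * (T + U) := by have := (hgrowth (T + U) hS₀).2; linarith
  have hint : (∫ t in T..(T + U), Z2 t) = (∫ t in (0:ℝ)..(T + U), Z2 t) - ∫ t in (0:ℝ)..T, Z2 t :=
    (intervalIntegral.integral_interval_sub_left (continuous_Z2.intervalIntegrable _ _)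
      (continuous_Z2.intervalIntegrable _ _)).symm
  have hlad : ∀ S, T ≤ S → C * log S / S ≤ |C| * (3 / 2 * T ^ (-(1 / 3) : ℝ)) := by
    intro S hTS
    have h0 : 0 ≤ log S / S := div_nonneg (log_nonneg (by linarith)) (by linarith)
    rw [mul_div_assoc]
    exact (mul_le_mul_of_nonneg_right (le_abs_self C) h0).trans
      (mul_le_mul_of_nonneg_left (log_div_self_le_rpow hT1 hTS) (abs_nonneg C))
  have hIT := abs_le.1 ((hC T hT₀).trans (hlad T le_rfl))
  have hIS := abs_le.1 ((hC (T + U) hS₀).trans (hlad (T + U) (by linarith)))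
  rw [← hx] at hIT
  rw [← hy] at hIS
  have hconv := mul_log_sub_tangent_bounds hx0 (hx0.trans hxy)
  have ha : aConst = -1 - D := by simp only [aConst, hD]; ring
  have hmain : (U * log x - aConst * U) * ((φ (T + U) - φ T) / (2 * U))
      = (log x - aConst) * (y - x) := by
    simp only [hy, hx]; field_simp
  have hchord : y - x ≤ R * M := by
    rcases le_total (1 / 3) ε with hε3 | hε3
    · have hTM : T ≤ M := by
        simpa only [rpow_one] using rpow_le_rpow_of_exponent_le hT1 (show (1:ℝ) ≤ 1 / 3 + 2 * ε by linarith)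
      have : k₂ / 2 * (T + U) ≤ k₂ / 2 * (M + M) := by gcongr
      linarith
    · have hMT : M ≤ T := by
        simpa only [rpow_one] using rpow_le_rpow_of_exponent_le hT1 (show (1:ℝ) / 3 + 2 * ε ≤ 1 by linarith)
      have hp : T ^ ((1:ℝ)/3 + ε) ≤ M := rpow_le_rpow_of_exponent_le hT1 (by linarith)
      have hq : (T + U) ^ ((1:ℝ)/3 + ε) ≤ 2 * M := by
        calc (T + U) ^ ((1:ℝ)/3 + ε) ≤ (2 * T) ^ ((1:ℝ)/3 + ε) := by gcongr; linarith
          _ = 2 ^ ((1:ℝ)/3 + ε) * T ^ ((1:ℝ)/3 + ε) := mul_rpow (by norm_num) hT0.le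
          _ ≤ 2 * M := by
            gcongr
            simpa only [rpow_one] using rpow_le_rpow_of_exponent_le (show (1:ℝ) ≤ 2 by norm_num)
              (show (1:ℝ) / 3 + ε ≤ 1 by linarith)
      have hbal : ∀ S b : ℝ, 0 ≤ S → S ^ ((1:ℝ)/3 + ε) ≤ b →
          B * S ^ ((1:ℝ)/3 + ε) ≤ |B| * b := fun S b hS hb =>
        (mul_le_mul_of_nonneg_right (le_abs_self B) (rpow_nonneg hS _)).trans
          (mul_le_mul_of_nonneg_left hb (abs_nonneg B))
      have hBT := (abs_le.1 ((hB T hT₁).trans (hbal T _ hT0.le hp))).1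
      have hBS := (abs_le.1 ((hB (T + U) (by linarith)).trans
        (hbal (T + U) _ (by linarith) hq))).2
      set L : ℝ := log T with hL
      have hLe : 2 * N + K + 1 ≤ L := (le_log_iff_exp_le hT0).2 hTe
      have hN0 : 0 ≤ N := by positivity
      have hK0 : 0 ≤ K := by have := log_nonneg (show (1:ℝ) ≤ 2 by norm_num); positivity
      have hlogS : log (T + U) ≤ log 2 + L := by
        rw [hL, ← log_mul (by norm_num) hT0.ne']
        exact log_le_log (by linarith) (by linarith)
      have hlogx : L - N ≤ log x - aConst := by
        have : log (k₁ / 2 * T) ≤ log x := log_le_log (by positivity) hxT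
        rw [log_mul (by positivity) hT0.ne'] at this
        linarith [neg_abs_le (log (k₁ / 2)), le_abs_self aConst]
      have hG := (mul_log_sub_tangent_bounds (show 0 < T + U by linarith) hT0).1
      have hGU : (T + U) * log (T + U) - T * L + A * U ≤ M * (log 2 + L + 1 + |A|) := by
        have h1 : log (T + U) + 1 + A ≤ log 2 + L + 1 + |A| := by linarith [le_abs_self A]
        have h2 : 0 ≤ log 2 + L + 1 + |A| := by
          have := log_nonneg (show (1:ℝ) ≤ 2 by norm_num)
          have := abs_nonneg A
          linarith
        linarith [mul_le_mul_of_nonneg_left h1 hU.le, mul_le_mul_of_nonneg_right hUM h2]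
      have hTneg : T ^ (-(1 / 3) : ℝ) ≤ M :=
        rpow_le_rpow_of_exponent_le hT1 (by linarith)
      have hCM := mul_le_mul_of_nonneg_left hTneg (abs_nonneg C)
      have hupper : (log x - aConst) * (y - x) ≤ M * (L + K) := by
        have hMK : M * K = M * (log 2 + 1 + |A| + 3 * |B| + 3 * |C|) := by rw [hK]
        rw [ha]
        linarith [hconv.1, hIS.2, hIT.1]
      have hlower : L / 2 * (y - x) ≤ (log x - aConst) * (y - x) := by
        gcongr <;> linarith
      have hMK : M * (L + K) ≤ M * (2 * L) := by gcongr; linarith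
      have h4 : L * (y - x) ≤ L * (4 * M) := by linarith
      have h5 : y - x ≤ 4 * M := le_of_mul_le_mul_left h4 (by linarith)
      have h6 : 0 ≤ k₂ * M := by positivity
      linarith
  have hsq : (y - x) ^ 2 / x ≤ R ^ 2 * (2 / k₁) * T ^ (-((1:ℝ)/3 - 4*ε)) := by
    have hMM : M ^ 2 = T ^ (-((1:ℝ)/3 - 4*ε)) * T := by
      rw [← rpow_add_one hT0.ne', hM, ← rpow_natCast, ← rpow_mul hT0.le]
      congr 1
      push_cast
      ring
    calc (y - x) ^ 2 / x ≤ (R * M) ^ 2 / (k₁ / 2 * T) := by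
          have : 0 ≤ y - x := by linarith
          gcongr
      _ = R ^ 2 * (2 / k₁) * T ^ (-((1:ℝ)/3 - 4*ε)) := by
          rw [mul_pow, hMM]; field_simp
  have hTexp : T ^ (-(1 / 3) : ℝ) ≤ T ^ (-((1:ℝ)/3 - 4*ε)) :=
    rpow_le_rpow_of_exponent_le hT1 (by linarith)
  have hCexp := mul_le_mul_of_nonneg_left hTexp (abs_nonneg C)
  have hsq0 : 0 ≤ (y - x) ^ 2 / x := by positivity
  rw [hint, hmain, ha, abs_le]
  constructor <;> linarith [hconv.1, hconv.2, hIS.1, hIS.2, hIT.1, hIT.2]
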